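/- Let I be an admissible ideal on ℕ, let λ = (λ_i) and μ = (μ_i) be elements of Λ with λ_i ≤ μ_i for all i ∈ ℕ, and let α, β be fixed reals with 0 < α ≤ β ≤ 1. Suppose liminf_{i→∞} λ_i^α / μ_i^β > 0. If a real sequence x = (x_j) is I_μ-summable of order β to Z (i.e. for every ε > 0, the set {i ∈ ℕ : μ_i^{−β} · Σ_{j ∈ J_i} |x_j − Z| ≥ ε} ∈ I), then x is I_λ-statistically convergent of order α to Z (i.e. for every ε > 0 and δ > 0, the set {i ∈ ℕ : λ_i^{−α} · |{j ∈ I_i : |x_j − Z| ≥ ε}| ≥ δ} ∈ I). -/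

import Mathlib

open Filter Finset

/-- An admissible ideal on ℕ: contains all finite sets, closed under subsets and
finite unions, and does not contain ℕ itself. -/
def AdmissibleIdeal (I : Set (Set ℕ)) : Prop :=
  (∀ A : Set ℕ, A.Finite → A ∈ I) ∧
  (∀ A B : Set ℕ, A ∈ I → B ⊆ A → B ∈ I) ∧
  (∀ A B : Set ℕ, A ∈ I → B ∈ I → A ∪ B ∈ I) ∧
  (Set.univ : Set ℕ) ∉ I

/-- Membership in Λ: a nondecreasing sequence of positive integers with `l i ≤ i`. -/
def InLambda (l : ℕ → ℕ) : Prop :=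
  Monotone l ∧ (∀ i, 0 < l i) ∧ ∀ i, 1 ≤ i → l i ≤ i

/-- The generalized de la Vallée-Poussin window `I_i = [i − λ_i + 1, i] ∩ ℕ`. -/
def window (l : ℕ → ℕ) (i : ℕ) : Finset ℕ := Finset.Icc (i - l i + 1) i

open Classical in
/-- `I_λ`-statistical convergence of order `α` to `Z` (plain version). -/
def IStatConv (I : Set (Set ℕ)) (l : ℕ → ℕ) (α : ℝ) (x : ℕ → ℝ) (Z : ℝ) : Prop :=
  ∀ ε > (0:ℝ), ∀ δ > (0:ℝ),
    {i : ℕ | δ ≤ ((l i : ℝ) ^ (-α)) *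
      ((window l i).filter (fun j => ε ≤ |x j - Z|)).card} ∈ I

/-- `I_λ`-summability of order `α` to `Z` (plain version). -/
def ISumm (I : Set (Set ℕ)) (l : ℕ → ℕ) (α : ℝ) (x : ℕ → ℝ) (Z : ℝ) : Prop :=
  ∀ ε > (0:ℝ),
    {i : ℕ | ε ≤ ((l i : ℝ) ^ (-α)) * ∑ j ∈ window l i, |x j - Z|} ∈ I

theorem window_subset_window {l m : ℕ → ℕ} {i : ℕ} (h : l i ≤ m i) :
    window l i ⊆ window m i :=
  Finset.Icc_subset_Icc_left (by omega)

open Classical in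
/-- Markov's inequality for the counting measure on a finite set. -/
theorem mul_card_filter_le_sum {s t : Finset ℕ} (hst : s ⊆ t) {f : ℕ → ℝ}
    (hf : ∀ j, 0 ≤ f j) (ε : ℝ) :
    ε * ((s.filter (fun j => ε ≤ f j)).card : ℝ) ≤ ∑ j ∈ t, f j := by
  calc ε * ((s.filter (fun j => ε ≤ f j)).card : ℝ)
      = ∑ _j ∈ s.filter (fun j => ε ≤ f j), ε := by
        rw [Finset.sum_const, nsmul_eq_mul, mul_comm]
    _ ≤ ∑ j ∈ s.filter (fun j => ε ≤ f j), f j :=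
        Finset.sum_le_sum fun j hj => (Finset.mem_filter.mp hj).2
    _ ≤ ∑ j ∈ t, f j :=
        Finset.sum_le_sum_of_subset_of_nonneg ((Finset.filter_subset _ _).trans hst)
          fun j _ _ => hf j

theorem summable_implies_statConv_of_liminf_pos
    (I : Set (Set ℕ)) (hI : AdmissibleIdeal I)
    (lam mu : ℕ → ℕ) (hlam : InLambda lam) (hmu : InLambda mu)
    (hle : ∀ i, lam i ≤ mu i)
    (α β : ℝ) (hα : 0 < α) (hαβ : α ≤ β) (hβ : β ≤ 1)
    (hliminf : 0 < Filter.atTop.liminf (fun i => (lam i : ℝ) ^ α / (mu i : ℝ) ^ β))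
    (x : ℕ → ℝ) (Z : ℝ)
    (hx : ISumm I mu β x Z) :
    IStatConv I lam α x Z := by
  classical
  obtain ⟨hfin, hsub, hunion, -⟩ := hI
  intro ε hε δ hδ
  obtain ⟨c, hc, hcl⟩ := exists_between hliminf
  have hbdd : Filter.atTop.IsBoundedUnder (· ≥ ·)
      (fun i => (lam i : ℝ) ^ α / (mu i : ℝ) ^ β) :=
    Filter.isBoundedUnder_of ⟨0, fun i => by positivity⟩
  obtain ⟨N, hN⟩ := Filter.eventually_atTop.mp (Filter.eventually_lt_of_lt_liminf hcl hbdd)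
  refine hsub _ _ (hunion _ _ (hx (c * ε * δ) (by positivity))
    (hfin (Set.Iio N) (Set.finite_Iio N))) ?_
  intro i hi
  rcases lt_or_ge i N with hiN | hiN
  · exact Or.inr hiN
  left
  simp only [Set.mem_ofPred_eq] at hi ⊢
  have hl : (0 : ℝ) < (lam i : ℝ) ^ α := Real.rpow_pos_of_pos (by exact_mod_cast hlam.2.1 i) _
  have hm : (0 : ℝ) < (mu i : ℝ) ^ β := Real.rpow_pos_of_pos (by exact_mod_cast hmu.2.1 i) _
  have hratio : c * (mu i : ℝ) ^ β < (lam i : ℝ) ^ α := (lt_div_iff₀ hm).mp (hN i hiN)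
  have hmarkov := mul_card_filter_le_sum (window_subset_window (hle i))
    (f := fun j => |x j - Z|) (fun j => abs_nonneg _) ε
  rw [Real.rpow_neg (Nat.cast_nonneg _), inv_mul_eq_div, le_div_iff₀ hl] at hi
  rw [Real.rpow_neg (Nat.cast_nonneg _), inv_mul_eq_div, le_div_iff₀ hm]
  calc c * ε * δ * (mu i : ℝ) ^ β = ε * (δ * (c * (mu i : ℝ) ^ β)) := by ring
    _ ≤ ε * (δ * (lam i : ℝ) ^ α) := by gcongr
    _ ≤ ε * ((window lam i).filter (fun j => ε ≤ |x j - Z|)).card := by gcongr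
    _ ≤ ∑ j ∈ window mu i, |x j - Z| := hmarkov
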